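/- Let a > 4b > 0 and suppose (a − b) − √(2(a − b)) > b + a/2 + √(3b) + √(3a/2). For even n = 2m, consider the two-cluster geometric block model GBM(n, r_s, r_d) with r_s = a·log n/n and r_d = b·log n/n, set E_S = (b + a/2 + √(3b) + √(3a/2))·log n/n and E_D = ((a − b) − √(2(a − b)))·log n/n, and for adjacent vertices u ≠ v let N(u,v) = #{z ∉ {u,v} : z is adjacent to u and z is not adjacent to v}. Then the probability of the event that for every adjacent pair u ≠ v, u and v lie in the same cluster if and only if |N(u,v)/n − E_S| < |N(u,v)/n − E_D|, tends to 1 as m → ∞. -/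

import Mathlib

open MeasureTheory

/-- The circular distance on `[0,1]`. -/
noncomputable def dL (x y : ℝ) : ℝ := min |x - y| (1 - |x - y|)

/-- The product of `n` copies of the uniform measure on `[0,1]`: the law of the
locations in the geometric block model on `n` vertices. -/
noncomputable def gbmP (n : ℕ) : Measure (Fin n → ℝ) :=
  Measure.pi fun _ => volume.restrict (Set.Icc (0 : ℝ) 1)

/-- Vertices `u, v` of `{0, …, 2m−1}` lie in the same cluster, where the clusters
are `{0, …, m−1}` and `{m, …, 2m−1}`. -/
abbrev sameCluster (m : ℕ) (u v : Fin (2 * m)) : Prop :=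
  ((u : ℕ) < m ↔ (v : ℕ) < m)

/-- Adjacency in the two-cluster geometric block model with intra-cluster radius
`r_s` and inter-cluster radius `r_d`, given locations `ω`. -/
def gbmAdj (m : ℕ) (rs rd : ℝ) (ω : Fin (2 * m) → ℝ) (u v : Fin (2 * m)) : Prop :=
  u ≠ v ∧ dL (ω u) (ω v) ≤ (if sameCluster m u v then rs else rd)

/-- `r(c, m) = c · log n / n` for `n = 2m`. -/
noncomputable def rr (c : ℝ) (m : ℕ) : ℝ := c * Real.log (2 * m) / (2 * m)

/-- Number of vertices forming Motif 2 with `u` and `v` (neighbors of `u` that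
are not neighbors of `v`). -/
noncomputable def cntMotif2 (m : ℕ) (rs rd : ℝ) (ω : Fin (2 * m) → ℝ) (u v : Fin (2 * m)) : ℕ :=
  Set.ncard {z : Fin (2 * m) | z ≠ u ∧ z ≠ v ∧ gbmAdj m rs rd ω z u ∧ ¬ gbmAdj m rs rd ω z v}


open scoped ENNReal

/-- On `[0,1]` the distance `dL` is the distance of the images on the unit circle. -/
lemma dL_eq_dist {x y : ℝ} (hx : x ∈ Set.Icc (0 : ℝ) 1) (hy : y ∈ Set.Icc (0 : ℝ) 1) :
    dL x y = dist (x : UnitAddCircle) (y : UnitAddCircle) := by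
  wlog hxy : y ≤ x generalizing x y
  · rw [dist_comm, ← this hy hx (le_of_not_ge hxy), dL, dL, abs_sub_comm]
  rw [dist_eq_norm, ← QuotientAddGroup.mk_sub, UnitAddCircle.norm_eq, abs_sub_round_eq_min, dL,
    abs_of_nonneg (sub_nonneg.2 hxy)]
  have h1 : x - y ≤ 1 := by linarith [hx.2, hy.1]
  rcases h1.lt_or_eq with h | h
  · rw [Int.fract_eq_self.2 ⟨sub_nonneg.2 hxy, h⟩]
  · rw [h]; simp

lemma volume_real_circle_closedBall_le (x : UnitAddCircle) {r : ℝ} (hr : 0 ≤ r) :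
    volume.real (Metric.closedBall x r) ≤ 2 * r := by
  rw [Measure.real, AddCircle.volume_closedBall]
  exact ENNReal.toReal_le_of_le_ofReal (by positivity)
    (ENNReal.ofReal_le_ofReal (min_le_right _ _))

lemma volume_real_circle_closedBall (x : UnitAddCircle) {r : ℝ} (hr : 0 ≤ r) (hr1 : 2 * r ≤ 1) :
    volume.real (Metric.closedBall x r) = 2 * r := by
  rw [Measure.real, AddCircle.volume_closedBall, min_eq_right hr1,
    ENNReal.toReal_ofReal (by positivity)]

lemma exists_circle_midpoint (x y : UnitAddCircle) :
    ∃ w : UnitAddCircle, dist w x ≤ dist x y / 2 ∧ dist w y ≤ dist x y / 2 := by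
  induction x using QuotientAddGroup.induction_on with | H s => ?_
  induction y using QuotientAddGroup.induction_on with | H t => ?_
  set e : ℝ := (s - t) - round (s - t) with he
  have hd : dist (s : UnitAddCircle) (t : UnitAddCircle) = |e| := by
    rw [dist_eq_norm, ← QuotientAddGroup.mk_sub, UnitAddCircle.norm_eq]
  have hbound : ∀ z : ℝ, ‖(z : UnitAddCircle)‖ ≤ |z| := fun z => by
    rw [UnitAddCircle.norm_eq]; simpa using round_le z 0
  have hs : (s : UnitAddCircle) = ((t + e : ℝ) : UnitAddCircle) := by
    rw [he, QuotientAddGroup.eq_iff_sub_mem]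
    exact ⟨round (s - t), by simp; ring⟩
  refine ⟨((t + e / 2 : ℝ) : UnitAddCircle), ?_, ?_⟩
  · rw [hd, hs, dist_eq_norm, ← QuotientAddGroup.mk_sub]
    refine (hbound _).trans (le_of_eq ?_)
    rw [show t + e / 2 - (t + e) = -(e / 2) by ring, abs_neg, abs_div, abs_two]
  · rw [hd, dist_eq_norm, ← QuotientAddGroup.mk_sub]
    refine (hbound _).trans (le_of_eq ?_)
    rw [show t + e / 2 - t = e / 2 by ring, abs_div, abs_two]

/-- Two balls of the same radius differ by at most the distance of their centres. -/
lemma volume_real_circle_closedBall_diff_le (x y : UnitAddCircle) {r : ℝ}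
    (hr1 : 2 * r ≤ 1) (hxy : dist x y ≤ r) :
    volume.real (Metric.closedBall x r \ Metric.closedBall y r) ≤ dist x y := by
  obtain ⟨w, hwx, hwy⟩ := exists_circle_midpoint x y
  have h0 : 0 ≤ dist x y := dist_nonneg
  have hsx : Metric.closedBall w (r - dist x y / 2) ⊆ Metric.closedBall x r :=
    Metric.closedBall_subset_closedBall' (by linarith)
  have hsy : Metric.closedBall w (r - dist x y / 2) ⊆ Metric.closedBall y r :=
    Metric.closedBall_subset_closedBall' (by linarith)
  calc volume.real (Metric.closedBall x r \ Metric.closedBall y r)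
      ≤ volume.real (Metric.closedBall x r \ Metric.closedBall w (r - dist x y / 2)) :=
        measureReal_mono (Set.sdiff_subset_sdiff_right hsy)
    _ = dist x y := by
        rw [measureReal_sdiff hsx Metric.isClosed_closedBall.measurableSet,
          volume_real_circle_closedBall _ (by linarith) hr1,
          volume_real_circle_closedBall _ (by linarith) (by linarith)]
        ring

lemma le_volume_real_circle_closedBall_diff (x y : UnitAddCircle) {r s : ℝ}
    (hr : 0 ≤ r) (hr1 : 2 * r ≤ 1) (hs : 0 ≤ s) :
    2 * r - 2 * s ≤ volume.real (Metric.closedBall x r \ Metric.closedBall y s) := by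
  have h := le_measureReal_sdiff (μ := (volume : Measure UnitAddCircle))
    (s₁ := Metric.closedBall x r) (s₂ := Metric.closedBall y s)
  rw [volume_real_circle_closedBall x hr hr1] at h
  linarith [volume_real_circle_closedBall_le y hs]

/-- The uniform measure on `[0,1]` of a set described by circular distances is the Haar measure of
the corresponding subset of the unit circle. -/
lemma restrict_Icc_real_eq_circle {A : Set ℝ} {B : Set UnitAddCircle} (hB : MeasurableSet B)
    (hAB : ∀ w ∈ Set.Icc (0 : ℝ) 1, w ∈ A ↔ (w : UnitAddCircle) ∈ B) :
    (volume.restrict (Set.Icc (0 : ℝ) 1)).real A = volume.real B := by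
  have h := (UnitAddCircle.measurePreserving_mk 0).measure_preimage hB.nullMeasurableSet
  rw [zero_add, restrict_Ioc_eq_restrict_Icc] at h
  rw [Measure.real, Measure.real, ← h]
  congr 1
  refine measure_congr ?_
  filter_upwards [ae_restrict_mem measurableSet_Icc] with w hw
  exact propext (hAB w hw)

lemma measurable_dL : Measurable fun p : ℝ × ℝ => dL p.1 p.2 := by
  unfold dL; fun_prop

/-- Tonelli for a finite product of functions of distinct coordinates. -/
lemma lintegral_pi_prod {ι X : Type*} [Fintype ι] [MeasurableSpace X] (μ : Measure X)
    [IsProbabilityMeasure μ] {g : ι → X → ℝ≥0∞} (hg : ∀ i, Measurable (g i)) :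
    ∫⁻ ω : ι → X, ∏ i, g i (ω i) ∂(Measure.pi fun _ => μ) = ∏ i, ∫⁻ y, g i y ∂μ := by
  rw [ProbabilityTheory.lintegral_prod_eq_prod_lintegral_of_indepFun Finset.univ
    (fun i (ω : ι → X) => g i (ω i))
    (ProbabilityTheory.iIndepFun_pi fun i => (hg i).aemeasurable)
    (fun i => (hg i).comp (measurable_pi_apply i))]
  exact Finset.prod_congr rfl fun i _ =>
    (measurePreserving_eval (fun _ : ι => μ) i).lintegral_comp (hg i)

/-- Conditionally on the coordinates `u` and `v`, the remaining coordinates are independent. -/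
lemma lintegral_pi_pair_prod_le {ι X : Type*} [Fintype ι] [DecidableEq ι] [MeasurableSpace X]
    (μ : Measure X) [IsProbabilityMeasure μ] {u v : ι} (huv : u ≠ v) {S : Set (X × X)}
    (hS : MeasurableSet S) {g : ι → X × X → X → ℝ≥0∞}
    (hg : ∀ z, Measurable (Function.uncurry (g z))) {C p : ℝ≥0∞}
    (hC : ∀ q ∈ S, ∏ z ∈ {u, v}ᶜ, ∫⁻ y, g z q y ∂μ ≤ C)
    (hp : ∀ x, μ {y | (x, y) ∈ S} ≤ p) :
    ∫⁻ ω : ι → X, S.indicator 1 (ω u, ω v) * ∏ z ∈ {u, v}ᶜ, g z (ω u, ω v) (ω z)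
      ∂(Measure.pi fun _ => μ) ≤ p * C := by
  have hpair : Measurable fun ω : ι → X => (ω u, ω v) := by fun_prop
  have hind : Measurable fun ω : ι → X => S.indicator (1 : X × X → ℝ≥0∞) (ω u, ω v) :=
    (measurable_one.indicator hS).comp hpair
  have hprod : Measurable fun ω : ι → X => ∏ z ∈ ({u, v}ᶜ : Finset ι), g z (ω u, ω v) (ω z) :=
    Finset.measurable_prod _ fun z _ => (hg z).comp (hpair.prodMk (measurable_pi_apply z))
  calc ∫⁻ ω : ι → X, S.indicator 1 (ω u, ω v) * ∏ z ∈ {u, v}ᶜ, g z (ω u, ω v) (ω z)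
        ∂(Measure.pi fun _ => μ)
      ≤ ∫⁻ ω : ι → X, S.indicator 1 (ω u, ω v) * C ∂(Measure.pi fun _ => μ) := by
        refine lintegral_le_of_lmarginal_le ({u, v}ᶜ : Finset ι) (hind.mul hprod)
          (hind.mul_const C) fun x => ?_
        have hu : ∀ y, Function.updateFinset x ({u, v}ᶜ : Finset ι) y u = x u := fun y => by
          simp [Function.updateFinset]
        have hv : ∀ y, Function.updateFinset x ({u, v}ᶜ : Finset ι) y v = x v := fun y => by
          simp [Function.updateFinset]
        simp only [lmarginal, hu, hv]
        by_cases hx : (x u, x v) ∈ S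
        · simp only [Set.indicator_of_mem hx, Pi.one_apply, one_mul, lintegral_const, measure_univ,
            mul_one]
          refine le_trans (le_of_eq ?_) (hC _ hx)
          have hgx : ∀ z : ({u, v}ᶜ : Finset ι), Measurable (g z (x u, x v)) := fun z =>
            (hg z).comp measurable_prodMk_left
          rw [← Finset.prod_coe_sort, ← lintegral_pi_prod μ hgx]
          refine lintegral_congr fun y => ?_
          rw [← Finset.prod_coe_sort]
          refine Finset.prod_congr rfl fun z _ => ?_
          simp only [Function.updateFinset, z.2, dite_true]
        · simp [Set.indicator_of_notMem hx]
    _ ≤ ∫⁻ _ : ι → X, p * C ∂(Measure.pi fun _ => μ) := by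
        refine lintegral_le_of_lmarginal_le {v} (hind.mul_const C) measurable_const fun x => ?_
        simp only [lmarginal_singleton, Function.update_self, Function.update_of_ne huv,
          lintegral_const, measure_univ, mul_one]
        have hm : MeasurableSet {y | (x u, y) ∈ S} := measurable_prodMk_left hS
        have hx : Measurable fun y => S.indicator (1 : X × X → ℝ≥0∞) (x u, y) :=
          (measurable_one.indicator hS).comp measurable_prodMk_left
        rw [lintegral_mul_const _ hx]
        gcongr
        refine le_trans (le_of_eq ?_) (hp (x u))
        rw [← lintegral_indicator_one hm]
        rfl
    _ = p * C := by simp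

/-- The moment generating function of an event is at most that of a Poisson variable. -/
lemma lintegral_exp_indicator_le {X : Type*} [MeasurableSpace X] (μ : Measure X)
    [IsProbabilityMeasure μ] {A : Set X} (hA : MeasurableSet A) (θ : ℝ) :
    ∫⁻ y, ENNReal.ofReal (Real.exp (θ * A.indicator 1 y)) ∂μ
      ≤ ENNReal.ofReal (Real.exp ((Real.exp θ - 1) * μ.real A)) := by
  have hint : Integrable (fun y => 1 + A.indicator (fun _ => Real.exp θ - 1) y) μ :=
    (integrable_const _).add ((integrable_const _).indicator hA)
  have heq : ∀ y, Real.exp (θ * A.indicator 1 y) = 1 + A.indicator (fun _ => Real.exp θ - 1) y := by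
    intro y
    by_cases hy : y ∈ A <;> simp [hy]
  simp_rw [heq]
  rw [← ofReal_integral_eq_lintegral_ofReal hint
    (Filter.Eventually.of_forall fun y => (Real.exp_pos _).le.trans_eq (heq y)),
    integral_add (integrable_const _) ((integrable_const _).indicator hA),
    integral_indicator_const _ hA]
  refine ENNReal.ofReal_le_ofReal ?_
  simp only [integral_const, probReal_univ, smul_eq_mul, mul_one]
  linarith [Real.add_one_le_exp ((Real.exp θ - 1) * μ.real A)]

/-- Chernoff bound, on an event of the coordinates `u` and `v`, for the number of other coordinates
falling in sets that depend on those two; positive and negative `θ` give the two tails. -/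
lemma chernoff_pair {ι X : Type*} [Fintype ι] [DecidableEq ι] [MeasurableSpace X]
    (μ : Measure X) [IsProbabilityMeasure μ] {u v : ι} (huv : u ≠ v) {S : Set (X × X)}
    (hS : MeasurableSet S) {A : ι → X × X → Set X}
    (hA : ∀ z, MeasurableSet {q : (X × X) × X | q.2 ∈ A z q.1}) {θ K t : ℝ} {p : ℝ≥0∞}
    (hK : ∀ q ∈ S, (Real.exp θ - 1) * ∑ z ∈ {u, v}ᶜ, μ.real (A z q) ≤ K)
    (hp : ∀ x, μ {y | (x, y) ∈ S} ≤ p) :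
    (Measure.pi fun _ : ι => μ) {ω | (ω u, ω v) ∈ S ∧
        t ≤ θ * ({z : ι | z ≠ u ∧ z ≠ v ∧ ω z ∈ A z (ω u, ω v)}.ncard : ℝ)}
      ≤ p * ENNReal.ofReal (Real.exp (K - t)) := by
  classical
  set g : ι → X × X → X → ℝ≥0∞ := fun z q y =>
    ENNReal.ofReal (Real.exp (θ * (A z q).indicator 1 y))
  have hg : ∀ z, Measurable (Function.uncurry (g z)) := fun z => by
    have h1 : Measurable ({q : (X × X) × X | q.2 ∈ A z q.1}.indicator (1 : (X × X) × X → ℝ)) :=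
      measurable_one.indicator (hA z)
    exact (Real.measurable_exp.comp (h1.const_mul θ)).ennreal_ofReal
  have hAq : ∀ z q, MeasurableSet (A z q) := fun z q => measurable_prodMk_left (hA z)
  have hC : ∀ q ∈ S, ∏ z ∈ {u, v}ᶜ, ∫⁻ y, g z q y ∂μ ≤ ENNReal.ofReal (Real.exp K) := by
    intro q hq
    calc ∏ z ∈ {u, v}ᶜ, ∫⁻ y, g z q y ∂μ
        ≤ ∏ z ∈ {u, v}ᶜ, ENNReal.ofReal (Real.exp ((Real.exp θ - 1) * μ.real (A z q))) :=
          Finset.prod_le_prod' fun z _ => lintegral_exp_indicator_le μ (hAq z q) θ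
      _ = ENNReal.ofReal (Real.exp ((Real.exp θ - 1) * ∑ z ∈ {u, v}ᶜ, μ.real (A z q))) := by
          rw [← ENNReal.ofReal_prod_of_nonneg fun _ _ => (Real.exp_pos _).le, ← Real.exp_sum,
            Finset.mul_sum]
      _ ≤ _ := ENNReal.ofReal_le_ofReal (Real.exp_le_exp.2 (hK q hq))
  have hmain := lintegral_pi_pair_prod_le μ huv hS hg hC hp
  have hpair : Measurable fun ω : ι → X => (ω u, ω v) := by fun_prop
  have hmeas : Measurable fun ω : ι → X =>
      S.indicator (1 : X × X → ℝ≥0∞) (ω u, ω v) * ∏ z ∈ {u, v}ᶜ, g z (ω u, ω v) (ω z) :=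
    ((measurable_one.indicator hS).comp hpair).mul <|
      Finset.measurable_prod _ fun z _ => (hg z).comp (hpair.prodMk (measurable_pi_apply z))
  have hcount : ∀ ω : ι → X, ∏ z ∈ {u, v}ᶜ, g z (ω u, ω v) (ω z) = ENNReal.ofReal (Real.exp
      (θ * ({z : ι | z ≠ u ∧ z ≠ v ∧ ω z ∈ A z (ω u, ω v)}.ncard : ℝ))) := by
    intro ω
    rw [← ENNReal.ofReal_prod_of_nonneg fun _ _ => (Real.exp_pos _).le, ← Real.exp_sum,
      ← Finset.mul_sum]
    congr 4
    have : {z : ι | z ≠ u ∧ z ≠ v ∧ ω z ∈ A z (ω u, ω v)} =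
        (({u, v}ᶜ : Finset ι).filter fun z => ω z ∈ A z (ω u, ω v) : Finset ι) := by
      ext z; simp [and_assoc]
    rw [this, Set.ncard_coe_finset, Finset.card_filter]
    push_cast
    exact Finset.sum_congr rfl fun z _ => by simp [Set.indicator_apply]
  have ht0 : ENNReal.ofReal (Real.exp t) ≠ 0 := by simp [Real.exp_pos]
  calc _ ≤ (Measure.pi fun _ : ι => μ) {ω | ENNReal.ofReal (Real.exp t) ≤
        S.indicator (1 : X × X → ℝ≥0∞) (ω u, ω v) * ∏ z ∈ {u, v}ᶜ, g z (ω u, ω v) (ω z)} := by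
        refine measure_mono fun ω hω => ?_
        simp only [Set.mem_ofPred_eq, hcount, Set.indicator_of_mem hω.1, Pi.one_apply, one_mul]
        exact ENNReal.ofReal_le_ofReal (Real.exp_le_exp.2 hω.2)
    _ ≤ _ := meas_ge_le_lintegral_div hmeas.aemeasurable ht0 ENNReal.ofReal_ne_top
    _ ≤ p * ENNReal.ofReal (Real.exp K) / ENNReal.ofReal (Real.exp t) := by gcongr
    _ = p * ENNReal.ofReal (Real.exp (K - t)) := by
        rw [mul_div_assoc, ← ENNReal.ofReal_div_of_pos (Real.exp_pos t), ← Real.exp_sub]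

lemma isProbabilityMeasure_restrict_Icc :
    IsProbabilityMeasure (volume.restrict (Set.Icc (0 : ℝ) 1)) :=
  ⟨by simp⟩

lemma restrict_Icc_real_dL_diff {x y : ℝ} (hx : x ∈ Set.Icc (0 : ℝ) 1) (hy : y ∈ Set.Icc (0 : ℝ) 1)
    (r s : ℝ) :
    (volume.restrict (Set.Icc (0 : ℝ) 1)).real {w | dL w x ≤ r ∧ ¬ dL w y ≤ s} =
      volume.real (Metric.closedBall (x : UnitAddCircle) r \
        Metric.closedBall (y : UnitAddCircle) s) :=
  restrict_Icc_real_eq_circle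
    (Metric.isClosed_closedBall.measurableSet.diff Metric.isClosed_closedBall.measurableSet)
    fun w hw => by
      simp only [Set.mem_ofPred_eq, Set.mem_sdiff, Metric.mem_closedBall, dL_eq_dist hw hx,
        dL_eq_dist hw hy]

lemma restrict_Icc_dL_le {x r : ℝ} (hr : 0 ≤ r) (hx : x ∈ Set.Icc (0 : ℝ) 1) :
    (volume.restrict (Set.Icc (0 : ℝ) 1)) {y | dL x y ≤ r} ≤ ENNReal.ofReal (2 * r) := by
  have := isProbabilityMeasure_restrict_Icc
  have h : (volume.restrict (Set.Icc (0 : ℝ) 1)).real {y | dL x y ≤ r} =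
      volume.real (Metric.closedBall (x : UnitAddCircle) r) :=
    restrict_Icc_real_eq_circle Metric.isClosed_closedBall.measurableSet fun w hw => by
      simp only [Set.mem_ofPred_eq, Metric.mem_closedBall, dL_eq_dist hx hw, dist_comm]
  rw [← ofReal_measureReal, h]
  exact ENNReal.ofReal_le_ofReal (volume_real_circle_closedBall_le _ hr)

/-- The connection radius of a pair of vertices. -/
noncomputable def gbmRadius (m : ℕ) (rs rd : ℝ) (u v : Fin (2 * m)) : ℝ :=
  if sameCluster m u v then rs else rd

lemma card_sameCluster (m : ℕ) (u : Fin (2 * m)) :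
    (Finset.univ.filter fun z : Fin (2 * m) => sameCluster m z u).card = m := by
  have hlt : (Finset.univ.filter fun z : Fin (2 * m) => (z : ℕ) < m).card = m := by
    rw [Fin.card_filter_val_lt]; omega
  by_cases hu : (u : ℕ) < m
  · simpa [sameCluster, hu] using hlt
  · have h := Finset.card_filter_add_card_filter_not (s := (Finset.univ : Finset (Fin (2 * m))))
      (fun z : Fin (2 * m) => (z : ℕ) < m)
    rw [hlt, Finset.card_univ, Fintype.card_fin] at h
    simp only [sameCluster, hu, iff_false]
    omega

/-- Chernoff bound for the Motif 2 count of an adjacent pair. -/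
lemma gbmP_adj_cntMotif2_le {m : ℕ} {rs rd : ℝ} {u v : Fin (2 * m)} (huv : u ≠ v)
    (hR : 0 ≤ gbmRadius m rs rd u v) {θ K t : ℝ}
    (hK : ∀ x y : UnitAddCircle, dist x y ≤ gbmRadius m rs rd u v →
      (Real.exp θ - 1) * ∑ z ∈ {u, v}ᶜ,
        volume.real (Metric.closedBall x (gbmRadius m rs rd z u) \
          Metric.closedBall y (gbmRadius m rs rd z v)) ≤ K) :
    gbmP (2 * m) {ω | (∀ i, ω i ∈ Set.Icc (0 : ℝ) 1) ∧ gbmAdj m rs rd ω u v ∧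
        t ≤ θ * (cntMotif2 m rs rd ω u v : ℝ)}
      ≤ ENNReal.ofReal (2 * gbmRadius m rs rd u v) * ENNReal.ofReal (Real.exp (K - t)) := by
  have := isProbabilityMeasure_restrict_Icc
  set R := gbmRadius m rs rd with hRdef
  set S : Set (ℝ × ℝ) := {q | q.1 ∈ Set.Icc (0 : ℝ) 1 ∧ q.2 ∈ Set.Icc (0 : ℝ) 1 ∧
    dL q.1 q.2 ≤ R u v}
  set A : Fin (2 * m) → ℝ × ℝ → Set ℝ := fun z q =>
    {w | dL w q.1 ≤ R z u ∧ ¬ dL w q.2 ≤ R z v} with hAdef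
  have hS : MeasurableSet S :=
    (measurable_fst measurableSet_Icc).inter <| (measurable_snd measurableSet_Icc).inter <|
      measurableSet_le measurable_dL measurable_const
  have hA : ∀ z, MeasurableSet {q : (ℝ × ℝ) × ℝ | q.2 ∈ A z q.1} := fun z =>
    (measurableSet_le (measurable_dL.comp (measurable_snd.prodMk measurable_fst.fst))
      measurable_const).inter
    (measurableSet_le (measurable_dL.comp (measurable_snd.prodMk measurable_fst.snd))
      measurable_const).compl
  refine le_trans (measure_mono ?_) (chernoff_pair (volume.restrict (Set.Icc (0 : ℝ) 1)) huv hS hA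
    (θ := θ) (K := K) (t := t) (p := ENNReal.ofReal (2 * R u v)) ?_ ?_)
  · rintro ω ⟨hω, hadj, ht⟩
    refine ⟨⟨hω u, hω v, hadj.2⟩, ht.trans_eq ?_⟩
    rw [cntMotif2]
    congr 3
    ext z
    simp only [Set.mem_ofPred_eq, gbmAdj, hAdef, hRdef, gbmRadius]
    tauto
  · rintro ⟨x, y⟩ ⟨hx, hy, hxy⟩
    rw [dL_eq_dist hx hy] at hxy
    refine le_trans (le_of_eq ?_) (hK x y hxy)
    congr 1
    exact Finset.sum_congr rfl fun z _ => restrict_Icc_real_dL_diff hx hy _ _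
  · intro x
    by_cases hx : x ∈ Set.Icc (0 : ℝ) 1
    · exact (measure_mono fun y hy => hy.2.2).trans (restrict_Icc_dL_le hR hx)
    · rw [show {y | (x, y) ∈ S} = ∅ from Set.eq_empty_of_forall_notMem fun y hy => hx hy.1]
      simp

lemma gbmP_sameCluster_upper_tail {m : ℕ} {rs rd : ℝ} (hrs : 0 ≤ rs) (hrs1 : 2 * rs ≤ 1)
    (hrd : 0 ≤ rd) {u v : Fin (2 * m)} (huv : u ≠ v) (hsame : sameCluster m u v)
    {θ : ℝ} (hθ : 0 ≤ θ) (t : ℝ) :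
    gbmP (2 * m) {ω | (∀ i, ω i ∈ Set.Icc (0 : ℝ) 1) ∧ gbmAdj m rs rd ω u v ∧
        t ≤ θ * (cntMotif2 m rs rd ω u v : ℝ)}
      ≤ ENNReal.ofReal (2 * rs) *
        ENNReal.ofReal (Real.exp ((Real.exp θ - 1) * (m * rs + m * (2 * rd)) - t)) := by
  have hR : gbmRadius m rs rd u v = rs := if_pos hsame
  have h := gbmP_adj_cntMotif2_le (rs := rs) (rd := rd) huv (by rwa [hR]) (θ := θ)
    (K := (Real.exp θ - 1) * (m * rs + m * (2 * rd))) (t := t) ?_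
  · rwa [hR] at h
  intro x y hxy
  rw [hR] at hxy
  refine mul_le_mul_of_nonneg_left ?_ (sub_nonneg.2 (Real.one_le_exp hθ))
  have hcard := card_sameCluster m u
  have hcard' : (Finset.univ.filter fun z : Fin (2 * m) => ¬ sameCluster m z u).card = m := by
    have h := Finset.card_filter_add_card_filter_not (s := (Finset.univ : Finset (Fin (2 * m))))
      (fun z : Fin (2 * m) => sameCluster m z u)
    rw [hcard, Finset.card_univ, Fintype.card_fin] at h
    omega
  calc ∑ z ∈ {u, v}ᶜ, volume.real (Metric.closedBall x (gbmRadius m rs rd z u) \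
          Metric.closedBall y (gbmRadius m rs rd z v))
      ≤ ∑ z ∈ {u, v}ᶜ, (if sameCluster m z u then rs else 2 * rd) := by
        refine Finset.sum_le_sum fun z _ => ?_
        have hzuv : sameCluster m z v ↔ sameCluster m z u := by
          simp only [sameCluster] at hsame ⊢; rw [hsame]
        by_cases hz : sameCluster m z u
        · rw [gbmRadius, gbmRadius, if_pos hz, if_pos (hzuv.2 hz), if_pos hz]
          exact (volume_real_circle_closedBall_diff_le x y hrs1 hxy).trans hxy
        · rw [gbmRadius, if_neg hz, if_neg hz]
          exact (measureReal_mono Set.sdiff_subset).trans (volume_real_circle_closedBall_le x hrd)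
    _ ≤ ∑ z, (if sameCluster m z u then rs else 2 * rd) := by
        refine Finset.sum_le_univ_sum_of_nonneg fun z => ?_
        split_ifs <;> positivity
    _ = m * rs + m * (2 * rd) := by
        rw [Finset.sum_ite, Finset.sum_const, Finset.sum_const, hcard, hcard', nsmul_eq_mul,
          nsmul_eq_mul]

lemma gbmP_not_sameCluster_lower_tail {m : ℕ} {rs rd : ℝ} (hrs1 : 2 * rs ≤ 1)
    (hrd : 0 ≤ rd) (hrsd : rd ≤ rs) {u v : Fin (2 * m)} (huv : u ≠ v) (hdiff : ¬ sameCluster m u v)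
    {θ : ℝ} (hθ : 0 ≤ θ) (t : ℝ) :
    gbmP (2 * m) {ω | (∀ i, ω i ∈ Set.Icc (0 : ℝ) 1) ∧ gbmAdj m rs rd ω u v ∧
        t ≤ -θ * (cntMotif2 m rs rd ω u v : ℝ)}
      ≤ ENNReal.ofReal (2 * rd) *
        ENNReal.ofReal (Real.exp ((Real.exp (-θ) - 1) * ((m - 1) * (2 * rs - 2 * rd)) - t)) := by
  have hR : gbmRadius m rs rd u v = rd := if_neg hdiff
  have h := gbmP_adj_cntMotif2_le (rs := rs) (rd := rd) huv (by rwa [hR]) (θ := -θ)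
    (K := (Real.exp (-θ) - 1) * ((m - 1) * (2 * rs - 2 * rd))) (t := t) ?_
  · rwa [hR] at h
  intro x y _
  refine mul_le_mul_of_nonpos_left ?_ (sub_nonpos.2 (Real.exp_le_one_iff.2 (by linarith)))
  set T := (Finset.univ.filter fun z : Fin (2 * m) => sameCluster m z u).erase u with hT
  have hm : 1 ≤ m := by have := u.2; omega
  have hcard : (T.card : ℝ) = m - 1 := by
    rw [hT, Finset.card_erase_of_mem (by simp [sameCluster]), card_sameCluster]
    push_cast [hm]; ring
  have hsub : T ⊆ ({u, v}ᶜ : Finset (Fin (2 * m))) := by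
    intro z hz
    simp only [hT, Finset.mem_erase, Finset.mem_filter, Finset.mem_univ, true_and] at hz
    simp only [Finset.mem_compl, Finset.mem_insert, Finset.mem_singleton, not_or]
    refine ⟨hz.1, ?_⟩
    rintro rfl
    exact hdiff hz.2.symm
  calc ((m : ℝ) - 1) * (2 * rs - 2 * rd) = ∑ z ∈ T, (2 * rs - 2 * rd) := by
        rw [Finset.sum_const, nsmul_eq_mul, hcard]
    _ ≤ ∑ z ∈ T, volume.real (Metric.closedBall x (gbmRadius m rs rd z u) \
          Metric.closedBall y (gbmRadius m rs rd z v)) := by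
        refine Finset.sum_le_sum fun z hz => ?_
        simp only [hT, Finset.mem_erase, Finset.mem_filter, Finset.mem_univ, true_and] at hz
        have hzv : ¬ sameCluster m z v := fun h => hdiff (hz.2.symm.trans h)
        rw [gbmRadius, gbmRadius, if_pos hz.2, if_neg hzv]
        exact le_volume_real_circle_closedBall_diff x y (hrd.trans hrsd) hrs1 hrd
    _ ≤ _ := Finset.sum_le_sum_of_subset_of_nonneg hsub fun _ _ _ => measureReal_nonneg

/-- A Chernoff parameter for the upper tail of a Poisson variable. -/
lemma exists_upper_tail_exponent {μ M : ℝ} (hμ : 3 < μ) (hM : μ + Real.sqrt (3 * μ) ≤ M) :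
    ∃ θ : ℝ, 0 < θ ∧ (Real.exp θ - 1) * μ - θ * M < -1 := by
  set q := Real.sqrt (3 * μ)
  have hq2 : q ^ 2 = 3 * μ := Real.sq_sqrt (by linarith)
  have hq3 : 3 < q := Real.lt_sqrt_of_sq_lt (by linarith)
  have hq0 : 0 < q := by linarith
  have hlog := Real.le_log_one_add_of_nonneg (x := 3 / q) (by positivity)
  have hlog' : 6 / (2 * q + 3) ≤ Real.log (1 + 3 / q) := by
    refine le_trans (le_of_eq ?_) hlog
    field_simp
    ring
  have hlogpos : 0 < Real.log (1 + 3 / q) := lt_of_lt_of_le (by positivity) hlog'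
  refine ⟨Real.log (1 + 3 / q), hlogpos, ?_⟩
  rw [Real.exp_log (by positivity)]
  have hqμ : (1 + 3 / q - 1) * μ = q := by
    have : μ = q ^ 2 / 3 := by linarith
    rw [this]; field_simp; ring
  have h1 : 6 / (2 * q + 3) * (μ + q) ≤ Real.log (1 + 3 / q) * M :=
    mul_le_mul hlog' hM (by linarith) hlogpos.le
  have h2 : q + 1 < 6 / (2 * q + 3) * (μ + q) := by
    rw [div_mul_eq_mul_div, lt_div_iff₀ (by positivity)]
    nlinarith
  linarith

/-- A Chernoff parameter for the lower tail of a Poisson variable. -/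
lemma exists_lower_tail_exponent {μ M : ℝ} (hμ : 0 < μ) (hM : M < μ - Real.sqrt (2 * μ)) :
    ∃ θ : ℝ, 0 < θ ∧ (Real.exp (-θ) - 1) * μ + θ * M < -1 := by
  set q := Real.sqrt (2 * μ)
  have hq2 : q ^ 2 = 2 * μ := Real.sq_sqrt (by linarith)
  have hq0 : 0 < q := Real.sqrt_pos.2 (by linarith)
  have hexp : Real.exp (-(2 / q)) ≤ 1 - 2 / q + (2 / q) ^ 2 / 2 := by
    have hx : 0 ≤ 2 / q := by positivity
    have h := Real.quadratic_le_exp_of_nonneg hx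
    rw [Real.exp_neg, inv_le_iff_one_le_mul₀ (Real.exp_pos _)]
    generalize 2 / q = x at *
    nlinarith [sq_nonneg (x ^ 2), sq_nonneg (x - 1)]
  refine ⟨2 / q, by positivity, ?_⟩
  have h1 : (Real.exp (-(2 / q)) - 1) * μ ≤ (-(2 / q) + (2 / q) ^ 2 / 2) * μ := by
    gcongr; linarith
  have h2 : 2 / q * M < 2 / q * (μ - q) := by gcongr
  have h3 : (-(2 / q) + (2 / q) ^ 2 / 2) * μ + 2 / q * (μ - q) = -1 := by
    have : μ = q ^ 2 / 2 := by linarith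
    rw [this]; field_simp; ring
  linarith

/-- For `x < y`, a point is nearer to `x` than to `y` iff it lies below their midpoint. -/
lemma abs_sub_lt_abs_sub_iff_lt_midpoint {x y c : ℝ} (hxy : x < y) :
    |c - x| < |c - y| ↔ c < (x + y) / 2 := by
  rw [← sq_lt_sq]
  constructor <;> intro h <;> nlinarith

lemma gbmP_compl_cube (n : ℕ) : gbmP n {ω | ¬ ∀ i, ω i ∈ Set.Icc (0 : ℝ) 1} = 0 := by
  have := isProbabilityMeasure_restrict_Icc
  rw [← ae_iff, ae_all_iff]
  intro i
  exact (measurePreserving_eval (fun _ : Fin n => volume.restrict (Set.Icc (0 : ℝ) 1))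
    i).quasiMeasurePreserving.ae (ae_restrict_mem measurableSet_Icc)

lemma tendsto_log_two_mul_nat :
    Filter.Tendsto (fun m : ℕ => Real.log (2 * m)) Filter.atTop Filter.atTop :=
  Real.tendsto_log_atTop.comp (tendsto_natCast_atTop_atTop.const_mul_atTop two_pos)

lemma tendsto_rr (c : ℝ) : Filter.Tendsto (rr c) Filter.atTop (nhds 0) := by
  have h : Filter.Tendsto (fun x : ℝ => Real.log x / x) Filter.atTop (nhds 0) :=
    Real.isLittleO_log_id_atTop.tendsto_div_nhds_zero
  have h2 := (h.comp (tendsto_natCast_atTop_atTop.const_mul_atTop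
    (two_pos : (0 : ℝ) < 2) : Filter.Tendsto (fun m : ℕ => 2 * (m : ℝ)) _ _)).const_mul c
  rw [mul_zero] at h2
  exact h2.congr fun m => by simp only [rr, Function.comp, mul_div_assoc]

/-- The union bound over all pairs vanishes in the limit. -/
lemma tendsto_union_bound (a : ℝ) {ε : ℝ} (hε : 0 < ε) :
    Filter.Tendsto (fun m : ℕ => ((2 * m : ℕ) : ℝ) ^ 2 *
      (2 * rr a m * Real.exp (1 - (1 + ε) * Real.log (2 * m)))) Filter.atTop (nhds 0) := by
  have h := ((Real.tendsto_pow_mul_exp_neg_atTop_nhds_zero 1).comp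
    (tendsto_log_two_mul_nat.const_mul_atTop hε)).const_mul (2 * a * Real.exp 1 / ε)
  rw [mul_zero] at h
  refine h.congr' ?_
  filter_upwards [Filter.eventually_ge_atTop 1] with m hm
  have hm0 : (0 : ℝ) < 2 * m := by positivity
  have he : Real.exp (1 - (1 + ε) * Real.log (2 * m)) =
      Real.exp 1 * (Real.exp (-(ε * Real.log (2 * m))) / (2 * m)) := by
    rw [show 1 - (1 + ε) * Real.log (2 * m) =
      1 + (-(ε * Real.log (2 * m)) - Real.log (2 * m)) by ring, Real.exp_add, Real.exp_sub,
      Real.exp_log hm0]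
  rw [he, rr]
  simp only [Function.comp, pow_one]
  push_cast
  field_simp

/-- Theorem 2 of the paper: in the two-cluster GBM with
`r_s = a log n / n`, `r_d = b log n / n`, `a > 4b > 0` and
`(a − b) − √(2(a − b)) > b + a/2 + √(3b) + √(3a/2)`, with probability `1 − o(1)`
the Motif-2 counting rule with thresholds `E_S`, `E_D` classifies every adjacent
pair correctly as same-cluster or different-cluster. -/
theorem gbm_motif2_recovery (a b : ℝ) (hb : 0 < b) (hab : 4 * b < a)
    (hcond : b + a / 2 + Real.sqrt (3 * b) + Real.sqrt (3 * a / 2)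
      < (a - b) - Real.sqrt (2 * (a - b))) :
    Filter.Tendsto (fun m : ℕ =>
      gbmP (2 * m)
        {ω | ∀ u v : Fin (2 * m), u ≠ v →
          gbmAdj m (rr a m) (rr b m) ω u v →
          (sameCluster m u v ↔
            |(cntMotif2 m (rr a m) (rr b m) ω u v : ℝ) / (2 * m)
                - (b + a / 2 + Real.sqrt (3 * b) + Real.sqrt (3 * a / 2)) * Real.log (2 * m) / (2 * m)|
              < |(cntMotif2 m (rr a m) (rr b m) ω u v : ℝ) / (2 * m)
                  - ((a - b) - Real.sqrt (2 * (a - b))) * Real.log (2 * m) / (2 * m)|)})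
      Filter.atTop (nhds 1) := by
  set ES := b + a / 2 + Real.sqrt (3 * b) + Real.sqrt (3 * a / 2) with hES
  set ED := (a - b) - Real.sqrt (2 * (a - b)) with hED
  set M := (ES + ED) / 2 with hM
  have ha : 0 < a := by linarith
  have hμ : 3 < b + a / 2 := by
    have h1 : Real.sqrt (3 * a / 2) < a / 2 := by
      linarith [Real.sqrt_nonneg (3 * b), Real.sqrt_nonneg (2 * (a - b))]
    rw [Real.sqrt_lt' (by linarith)] at h1
    nlinarith
  have hupper : b + a / 2 + Real.sqrt (3 * (b + a / 2)) ≤ M := by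
    have h1 : Real.sqrt (3 * (b + a / 2)) ≤ Real.sqrt (3 * b) + Real.sqrt (3 * a / 2) := by
      rw [show 3 * (b + a / 2) = 3 * b + 3 * a / 2 by ring]
      refine Real.sqrt_le_iff.2 ⟨by positivity, ?_⟩
      nlinarith [Real.sq_sqrt (show 0 ≤ 3 * b by positivity),
        Real.sq_sqrt (show 0 ≤ 3 * a / 2 by positivity),
        mul_nonneg (Real.sqrt_nonneg (3 * b)) (Real.sqrt_nonneg (3 * a / 2))]
    linarith
  obtain ⟨θ, hθ, hθM⟩ := exists_upper_tail_exponent hμ hupper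
  obtain ⟨θ', hθ', hθM'⟩ := exists_lower_tail_exponent (μ := a - b) (M := M) (by linarith)
    (by linarith)
  obtain ⟨ε, hε, hεθ, hεθ'⟩ : ∃ ε : ℝ, 0 < ε ∧
      (Real.exp θ - 1) * (b + a / 2) - θ * M ≤ -(1 + ε) ∧
      (Real.exp (-θ') - 1) * (a - b) + θ' * M ≤ -(1 + ε) := by
    refine ⟨min (-1 - ((Real.exp θ - 1) * (b + a / 2) - θ * M))
      (-1 - ((Real.exp (-θ') - 1) * (a - b) + θ' * M)), lt_min (by linarith) (by linarith), ?_, ?_⟩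
    · linarith [min_le_left (-1 - ((Real.exp θ - 1) * (b + a / 2) - θ * M))
        (-1 - ((Real.exp (-θ') - 1) * (a - b) + θ' * M))]
    · linarith [min_le_right (-1 - ((Real.exp θ - 1) * (b + a / 2) - θ * M))
        (-1 - ((Real.exp (-θ') - 1) * (a - b) + θ' * M))]
  set Q : ℕ → ℝ := fun m => ((2 * m : ℕ) : ℝ) ^ 2 *
    (2 * rr a m * Real.exp (1 - (1 + ε) * Real.log (2 * m)))
  have hlim : Filter.Tendsto (fun m => 1 - ENNReal.ofReal (Q m)) Filter.atTop (nhds 1) := by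
    have h := ENNReal.Tendsto.sub (tendsto_const_nhds (x := (1 : ℝ≥0∞)))
      (ENNReal.tendsto_ofReal (tendsto_union_bound a hε)) (Or.inl ENNReal.one_ne_top)
    rwa [ENNReal.ofReal_zero, tsub_zero] at h
  have hprob := isProbabilityMeasure_restrict_Icc
  have hP : ∀ n, IsProbabilityMeasure (gbmP n) := fun n => by unfold gbmP; infer_instance
  refine tendsto_of_tendsto_of_tendsto_of_le_of_le' hlim tendsto_const_nhds ?_
    (Filter.Eventually.of_forall fun m => prob_le_one)
  filter_upwards [Filter.eventually_ge_atTop 1,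
    (tendsto_rr a).eventually (eventually_le_nhds (by norm_num : (0 : ℝ) < 1 / 2))] with m hm hra
  set L := Real.log (2 * m) with hL
  have hm1 : (1 : ℝ) ≤ m := by exact_mod_cast hm
  have hm0 : (0 : ℝ) < 2 * m := by linarith
  have hL0 : 0 < L := Real.log_pos (by linarith)
  have hrs : 0 ≤ rr a m := by unfold rr; positivity
  have hrd : 0 ≤ rr b m := by unfold rr; positivity
  have hrsd : rr b m ≤ rr a m := by unfold rr; gcongr; linarith
  have hrs1 : 2 * rr a m ≤ 1 := by linarith
  have hma : (m : ℝ) * rr a m = a / 2 * L := by rw [rr, ← hL]; field_simp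
  have hmb : (m : ℝ) * rr b m = b / 2 * L := by rw [rr, ← hL]; field_simp
  have hrule : ∀ c : ℝ, |c / (2 * m) - ES * L / (2 * m)| < |c / (2 * m) - ED * L / (2 * m)| ↔
      c < M * L := by
    intro c
    rw [abs_sub_lt_abs_sub_iff_lt_midpoint (by gcongr), ← add_div, div_right_comm,
      div_lt_div_iff_of_pos_right hm0, hM]
    constructor <;> intro h <;> linarith
  simp only [hrule]
  set bad : Fin (2 * m) × Fin (2 * m) → Set (Fin (2 * m) → ℝ) := fun p =>
    {ω | (∀ i, ω i ∈ Set.Icc (0 : ℝ) 1) ∧ p.1 ≠ p.2 ∧ gbmAdj m (rr a m) (rr b m) ω p.1 p.2 ∧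
      ¬ (sameCluster m p.1 p.2 ↔ (cntMotif2 m (rr a m) (rr b m) ω p.1 p.2 : ℝ) < M * L)}
  have hpair : ∀ p, gbmP (2 * m) (bad p) ≤
      ENNReal.ofReal (2 * rr a m * Real.exp (1 - (1 + ε) * L)) := by
    rintro ⟨u, v⟩
    rw [ENNReal.ofReal_mul (by positivity)]
    by_cases huv : u = v
    · have : bad (u, v) = ∅ := Set.eq_empty_of_forall_notMem fun ω hω => hω.2.1 huv
      simp [this]
    by_cases hs : sameCluster m u v
    · refine (measure_mono ?_).trans ((gbmP_sameCluster_upper_tail hrs hrs1 hrd huv hs hθ.le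
        (θ * (M * L))).trans ?_)
      · rintro ω ⟨hω, -, hadj, hcnt⟩
        refine ⟨hω, hadj, mul_le_mul_of_nonneg_left ?_ hθ.le⟩
        by_contra! h
        exact hcnt (iff_of_true hs h)
      · refine mul_le_mul_right (ENNReal.ofReal_le_ofReal (Real.exp_le_exp.2 ?_)) _
        have h := mul_le_mul_of_nonneg_right hεθ hL0.le
        have e : (m : ℝ) * rr a m + m * (2 * rr b m) = (b + a / 2) * L := by linarith
        rw [e]
        linarith
    · refine (measure_mono ?_).trans ((gbmP_not_sameCluster_lower_tail hrs1 hrd hrsd huv hs hθ'.le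
        (-θ' * (M * L))).trans ?_)
      · rintro ω ⟨hω, -, hadj, hcnt⟩
        refine ⟨hω, hadj, mul_le_mul_of_nonpos_left ?_ (by linarith)⟩
        by_contra! h
        exact hcnt (iff_of_false hs h.not_gt)
      · refine mul_le_mul' (ENNReal.ofReal_le_ofReal (by linarith))
          (ENNReal.ofReal_le_ofReal (Real.exp_le_exp.2 ?_))
        have h := mul_le_mul_of_nonneg_right hεθ' hL0.le
        have e : ((m : ℝ) - 1) * (2 * rr a m - 2 * rr b m) =
          (a - b) * L - 2 * (rr a m - rr b m) := by linarith
        have h2 : (1 - Real.exp (-θ')) * (2 * (rr a m - rr b m)) ≤ 1 * 1 := by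
          gcongr <;> linarith [Real.exp_pos (-θ')]
        rw [e]
        linarith
  set good : Set (Fin (2 * m) → ℝ) := {ω | ∀ u v : Fin (2 * m), u ≠ v →
    gbmAdj m (rr a m) (rr b m) ω u v →
    (sameCluster m u v ↔ (cntMotif2 m (rr a m) (rr b m) ω u v : ℝ) < M * L)} with hgood
  have hcover : (Set.univ : Set (Fin (2 * m) → ℝ)) ⊆
      good ∪ ({ω | ¬ ∀ i, ω i ∈ Set.Icc (0 : ℝ) 1} ∪ ⋃ p, bad p) := by
    intro ω _
    by_cases hω : ∀ i, ω i ∈ Set.Icc (0 : ℝ) 1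
    · by_cases hg : ω ∈ good
      · exact Or.inl hg
      · simp only [hgood, Set.mem_ofPred_eq, not_forall] at hg
        obtain ⟨u, v, huv, hadj, hcnt⟩ := hg
        exact Or.inr (Or.inr (Set.mem_iUnion.2 ⟨(u, v), hω, huv, hadj, hcnt⟩))
    · exact Or.inr (Or.inl hω)
  rw [tsub_le_iff_right]
  calc (1 : ℝ≥0∞) = gbmP (2 * m) Set.univ := measure_univ.symm
    _ ≤ gbmP (2 * m) good + (gbmP (2 * m) {ω | ¬ ∀ i, ω i ∈ Set.Icc (0 : ℝ) 1} +
        ∑ p, gbmP (2 * m) (bad p)) :=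
        (measure_mono hcover).trans <| (measure_union_le _ _).trans <| by
          gcongr
          exact (measure_union_le _ _).trans (by gcongr; exact measure_iUnion_fintype_le _ _)
    _ ≤ gbmP (2 * m) good + (0 + ∑ _p : Fin (2 * m) × Fin (2 * m),
        ENNReal.ofReal (2 * rr a m * Real.exp (1 - (1 + ε) * L))) := by
        gcongr
        · exact (gbmP_compl_cube _).le
        · exact hpair _
    _ = gbmP (2 * m) good + ENNReal.ofReal (Q m) := by
        rw [zero_add, Finset.sum_const, Finset.card_univ, Fintype.card_prod, Fintype.card_fin,
          nsmul_eq_mul, ENNReal.ofReal_mul (p := ((2 * m : ℕ) : ℝ) ^ 2) (by positivity),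
          ← Nat.cast_pow, ENNReal.ofReal_natCast, sq]
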